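/- arXiv:2107.13622 — 2 statements merged into one kernel-verified Lean document; each statement's English description precedes it below -/
import Mathlib

section
/- Let τ > 0, N ∈ ℕ with N ≥ 1, and let D_1, …, D_N ⊆ ℝ^d be nonempty closed sets, each with nonempty frontier, satisfying D_{j+1} ⊆ H_τ(D_j) for j = 1, …, N−1, where H_τ(D_j) = { x ∈ D_j : dist(x, ∂D_j) ≥ τ }. Then for all indices 1 ≤ k ≤ j ≤ N, one has D_j ⊆ D_k, and moreover every x ∈ D_j satisfies dist(x, ∂D_k) ≥ (j − k)·τ; that is, D_j ⊆ H_{(j−k)τ}(D_k). -/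
/-- The `τ`-thinning of a set `E`: points of `E` at distance at least `τ` from the
frontier of `E`. -/
def tauThinning {d : ℕ} (τ : ℝ) (E : Set (EuclideanSpace ℝ (Fin d))) :
    Set (EuclideanSpace ℝ (Fin d)) :=
  {x ∈ E | τ ≤ Metric.infDist x (frontier E)}

/-- A segment from a point of `S` to a point outside the interior of `S` meets the frontier
of `S`. -/
theorem exists_mem_segment_mem_frontier {E : Type*} [NormedAddCommGroup E] [NormedSpace ℝ E]
    {S : Set E} {x y : E} (hx : x ∈ S) (hy : y ∉ interior S) :
    ∃ z ∈ segment ℝ x y, z ∈ frontier S := by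
  rw [frontier_eq_closure_inter_closure]
  refine isPreconnected_closed_iff.1 (convex_segment x y).isPreconnected _ _ isClosed_closure
    isClosed_closure (fun z _ => ?_) ⟨x, left_mem_segment ℝ x y, subset_closure hx⟩
    ⟨y, right_mem_segment ℝ x y, by rwa [closure_compl]⟩
  exact (em (z ∈ S)).imp (fun h => subset_closure h) (fun h => subset_closure h)

/-- If every point of the closed set `S ⊆ T` has distance at least `r` from the frontier of `T`,
then a point of `S` at distance at least `t` from the frontier of `S` has distance at least
`r + t` from the frontier of `T`. -/
theorem add_le_infDist_frontier {E : Type*} [NormedAddCommGroup E] [NormedSpace ℝ E]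
    {S T : Set E} (hS : IsClosed S) (hT : (frontier T).Nonempty) (hST : S ⊆ T) {r t : ℝ}
    (hr : ∀ z ∈ S, r ≤ Metric.infDist z (frontier T)) {x : E} (hx : x ∈ S)
    (ht : t ≤ Metric.infDist x (frontier S)) :
    r + t ≤ Metric.infDist x (frontier T) := by
  refine (Metric.le_infDist hT).2 fun y hy => ?_
  obtain ⟨z, hz, hzS⟩ := exists_mem_segment_mem_frontier hx
    fun h => hy.2 (interior_mono hST h)
  have hxz := ht.trans (Metric.infDist_le_dist_of_mem hzS)
  have hzy := (hr z (hS.frontier_subset hzS)).trans (Metric.infDist_le_dist_of_mem hy)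
  linarith [dist_add_dist_of_mem_segment hz]

/-- For nested layers `D_1, …, D_N` of nonempty closed sets with nonempty frontiers,
satisfying `D_{j+1} ⊆ H_τ(D_j)`, one has `D_j ⊆ D_k` for all `1 ≤ k ≤ j ≤ N`, and every
`x ∈ D_j` satisfies `dist(x, ∂D_k) ≥ (j - k)·τ`, i.e. `D_j ⊆ H_{(j-k)τ}(D_k)`. -/
theorem layers_nested_thinning {d : ℕ} (τ : ℝ) (hτ : 0 < τ) (N : ℕ) (hN : 1 ≤ N)
    (D : ℕ → Set (EuclideanSpace ℝ (Fin d)))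
    (hne : ∀ j, 1 ≤ j → j ≤ N → (D j).Nonempty)
    (hcl : ∀ j, 1 ≤ j → j ≤ N → IsClosed (D j))
    (hfr : ∀ j, 1 ≤ j → j ≤ N → (frontier (D j)).Nonempty)
    (hsub : ∀ j, 1 ≤ j → j < N → D (j + 1) ⊆ tauThinning τ (D j)) :
    ∀ k j, 1 ≤ k → k ≤ j → j ≤ N →
      D j ⊆ D k ∧
      (∀ x ∈ D j, ((j : ℝ) - (k : ℝ)) * τ ≤ Metric.infDist x (frontier (D k))) ∧
      D j ⊆ tauThinning (((j : ℝ) - (k : ℝ)) * τ) (D k) := by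
  intro k j hk hkj
  induction j, hkj using Nat.le_induction with
  | base =>
    intro _
    have h : ∀ x ∈ D k, ((k : ℝ) - (k : ℝ)) * τ ≤ Metric.infDist x (frontier (D k)) := by
      intro x _
      simpa using Metric.infDist_nonneg
    exact ⟨subset_rfl, h, fun x hx => ⟨hx, h x hx⟩⟩
  | succ j hkj ih =>
    intro hj
    obtain ⟨hjk, hdist, -⟩ := ih (by omega)
    have hstep := hsub j (by omega) (by omega)
    have hsubset : D (j + 1) ⊆ D k := fun x hx => hjk (hstep hx).1
    have h : ∀ x ∈ D (j + 1),
        (((j + 1 : ℕ) : ℝ) - (k : ℝ)) * τ ≤ Metric.infDist x (frontier (D k)) := by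
      intro x hx
      have hadd := add_le_infDist_frontier (hcl j (by omega) (by omega))
        (hfr k hk (by omega)) hjk hdist (hstep hx).1 (hstep hx).2
      push_cast
      linarith
    exact ⟨hsubset, h, fun x hx => ⟨hsubset hx, h x hx⟩⟩
end

section
/- Let τ > 0, N ≥ 1, and let D_1, …, D_N ⊆ ℝ^d be nonempty bounded closed sets satisfying D_{j+1} ⊆ H_τ(D_j) for j = 1, …, N−1, each D_j having finitely many connected components D_{j,1}, …, D_{j,N_j}. Let γ = c_0 + Σ_{j=1}^{N} Σ_{n=1}^{N_j} c_{j,n} χ_{D_{j,n}} be a PCLC coefficient on Ω ⊇ D_1 with layer-truncations γ_k. Fix k ∈ {0, …, N−1} and a connected component D_{k+1,m} of D_{k+1}. Then for every x in the outer τ-layer F_τ(D_{k+1,m}) = { x ∈ D_{k+1,m} : dist(x, ∂D_{k+1,m}) < τ }, one has γ(x) = γ_k(x) + c_{k+1,m}. -/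
/-- The outer `τ`-layer of a set `E`: points of `E` at distance less than `τ` from the
frontier of `E`. -/
def tauLayer {d : ℕ} (τ : ℝ) (E : Set (EuclideanSpace ℝ (Fin d))) :
    Set (EuclideanSpace ℝ (Fin d)) :=
  {x ∈ E | Metric.infDist x (frontier E) < τ}

/-- The `k`-th layer-truncated conductivity
`γ_k = c₀ + ∑_{j=1}^{k} ∑_{n=1}^{N_j} c_{j,n} χ_{D_{j,n}}`, where `comp j n` is the
`n`-th connected component `D_{j,n}` of the `j`-th layer `D_j` and `Nc j = N_j`. -/
noncomputable def layerTrunc {d : ℕ} (c₀ : ℝ) (Nc : ℕ → ℕ) (c : ℕ → ℕ → ℝ)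
    (comp : ℕ → ℕ → Set (EuclideanSpace ℝ (Fin d))) (k : ℕ)
    (x : EuclideanSpace ℝ (Fin d)) : ℝ :=
  c₀ + ∑ j ∈ Finset.Icc 1 k, ∑ n ∈ Finset.Icc 1 (Nc j),
    (comp j n).indicator (fun _ => c j n) x

theorem frontier_connectedComponentIn_subset {X : Type*} [TopologicalSpace X]
    [LocallyConnectedSpace X] (F : Set X) (x : X) :
    frontier (connectedComponentIn F x) ⊆ frontier F := by
  intro y hy
  refine ⟨closure_mono (connectedComponentIn_subset F x) hy.1, fun hyF => hy.2 ?_⟩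
  have hW : IsOpen (connectedComponentIn (interior F) y) :=
    isOpen_interior.connectedComponentIn
  obtain ⟨z, hzW, hzC⟩ :=
    mem_closure_iff.1 hy.1 _ hW (mem_connectedComponentIn hyF)
  have hWC : connectedComponentIn (interior F) y ⊆ connectedComponentIn F x := by
    rw [connectedComponentIn_eq hzC]
    exact isPreconnected_connectedComponentIn.subset_connectedComponentIn hzW
      ((connectedComponentIn_subset _ _).trans interior_subset)
  exact mem_interior.2 ⟨_, hWC, hW, mem_connectedComponentIn hyF⟩

/-- The outer `τ`-layer of a component of `E` misses the `τ`-thinning of `E`. -/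
theorem notMem_tauThinning_of_mem_tauLayer_connectedComponentIn {d : ℕ} {τ : ℝ} (hτ : 0 < τ)
    {E : Set (EuclideanSpace ℝ (Fin d))} {x y : EuclideanSpace ℝ (Fin d)}
    (hx : x ∈ tauLayer τ (connectedComponentIn E y)) : x ∉ tauThinning τ E := by
  intro hxE
  have hlt := hx.2
  have hle := hxE.2
  rcases (frontier (connectedComponentIn E y)).eq_empty_or_nonempty with h | h
  · rcases frontier_eq_empty_iff.1 h with h' | h'
    · simpa [h'] using hx.1
    · have hE : E = Set.univ :=
        Set.eq_univ_of_univ_subset (h' ▸ connectedComponentIn_subset E y)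
      rw [hE, frontier_univ, Metric.infDist_empty] at hle
      linarith
  · linarith [Metric.infDist_le_infDist_of_subset (x := x)
      (frontier_connectedComponentIn_subset E y) h]

/-- For a PCLC coefficient `γ = γ_N` with nonempty bounded closed layers
`D_{j+1} ⊆ H_τ(D_j)`, fix `k ∈ {0, …, N-1}` and a connected component `D_{k+1,m}` of
`D_{k+1}`. Then for every `x` in the outer `τ`-layer `F_τ(D_{k+1,m})` one has
`γ(x) = γ_k(x) + c_{k+1,m}`. -/
theorem pclc_on_outer_layer_of_component {d : ℕ} (τ : ℝ) (hτ : 0 < τ)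
    (N : ℕ) (hN : 1 ≤ N)
    (D : ℕ → Set (EuclideanSpace ℝ (Fin d))) (Ω : Set (EuclideanSpace ℝ (Fin d)))
    (hne : ∀ j, 1 ≤ j → j ≤ N → (D j).Nonempty)
    (hcl : ∀ j, 1 ≤ j → j ≤ N → IsClosed (D j))
    (hbd : ∀ j, 1 ≤ j → j ≤ N → Bornology.IsBounded (D j))
    (hsub : ∀ j, 1 ≤ j → j < N → D (j + 1) ⊆ tauThinning τ (D j))
    (hD₁ : D 1 ⊆ Ω)
    (Nc : ℕ → ℕ) (comp : ℕ → ℕ → Set (EuclideanSpace ℝ (Fin d)))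
    (hcompUnion : ∀ j, 1 ≤ j → j ≤ N → D j = ⋃ n ∈ Finset.Icc 1 (Nc j), comp j n)
    (hcompComp : ∀ j, 1 ≤ j → j ≤ N → ∀ n ∈ Finset.Icc 1 (Nc j),
      ∃ x ∈ D j, comp j n = connectedComponentIn (D j) x)
    (hcompNe : ∀ j, 1 ≤ j → j ≤ N → ∀ n ∈ Finset.Icc 1 (Nc j),
      ∀ n' ∈ Finset.Icc 1 (Nc j), n ≠ n' → comp j n ≠ comp j n')
    (c₀ : ℝ) (hc₀ : 0 < c₀) (c : ℕ → ℕ → ℝ)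
    (hc : ∀ j ∈ Finset.Icc 1 N, ∀ n ∈ Finset.Icc 1 (Nc j), c j n ≠ 0)
    (hpos : ∀ x ∈ Ω, 0 < layerTrunc c₀ Nc c comp N x)
    (k : ℕ) (hk : k < N) (m : ℕ) (hm : m ∈ Finset.Icc 1 (Nc (k + 1))) :
    ∀ x ∈ tauLayer τ (comp (k + 1) m),
      layerTrunc c₀ Nc c comp N x = layerTrunc c₀ Nc c comp k x + c (k + 1) m := by
  intro x hx
  obtain ⟨y, -, hCy⟩ := hcompComp (k + 1) (by lia) hk m hm
  have hsubD : ∀ j, 1 ≤ j → j ≤ N → ∀ n ∈ Finset.Icc 1 (Nc j), comp j n ⊆ D j := by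
    intro j h1 h2 n hn
    rw [hcompUnion j h1 h2]
    exact Set.subset_biUnion_of_mem (u := comp j) hn
  have hdeep : ∀ j, k + 2 ≤ j → j ≤ N → x ∉ D j := by
    intro j hj
    induction j, hj using Nat.le_induction with
    | base =>
      exact fun hN' hxD => notMem_tauThinning_of_mem_tauLayer_connectedComponentIn hτ
        (hCy ▸ hx) (hsub (k + 1) (by lia) (by lia) hxD)
    | succ j hj ih =>
      exact fun hN' hxD => ih (by lia) (hsub j (by lia) (by lia) hxD).1
  have hlayer : ∑ n ∈ Finset.Icc 1 (Nc (k + 1)),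
      (comp (k + 1) n).indicator (fun _ => c (k + 1) n) x = c (k + 1) m := by
    rw [Finset.sum_eq_single_of_mem m hm, Set.indicator_of_mem hx.1]
    intro n hn hnm
    refine Set.indicator_of_notMem (fun hxn => ?_) _
    refine hcompNe (k + 1) (by lia) hk n hn m hm hnm ?_
    obtain ⟨z, -, hCz⟩ := hcompComp (k + 1) (by lia) hk n hn
    have hxm := hx.1
    rw [hCz] at hxn ⊢
    rw [hCy] at hxm ⊢
    rw [connectedComponentIn_eq hxn, connectedComponentIn_eq hxm]
  have htrunc : ∑ j ∈ Finset.Icc 1 (k + 1), ∑ n ∈ Finset.Icc 1 (Nc j),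
      (comp j n).indicator (fun _ => c j n) x =
      ∑ j ∈ Finset.Icc 1 N, ∑ n ∈ Finset.Icc 1 (Nc j),
        (comp j n).indicator (fun _ => c j n) x := by
    refine Finset.sum_subset (Finset.Icc_subset_Icc_right hk) fun j hj hjk => ?_
    rw [Finset.mem_Icc] at hj hjk
    refine Finset.sum_eq_zero fun n hn => Set.indicator_of_notMem (fun hxn => ?_) _
    exact hdeep j (by lia) hj.2 (hsubD j hj.1 hj.2 n hn hxn)
  rw [layerTrunc, layerTrunc, ← htrunc, Finset.sum_Icc_succ_top (by lia), hlayer, add_assoc]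
end
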